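/- Let σ ∈ (0,1), let A be an index set, and for each a ∈ A let K_a = K_a(y) ∈ L₀ be a kernel independent of (t,x), and f_a : ℝ₀^{d+1} → ℝ with sup_{a∈A} ‖f_a‖_{L∞(ℝ₀^{d+1})} < ∞. Suppose u : ℝ₀^{d+1} → ℝ is smooth, δu(t,x,·) is integrable against (2−σ)|y|^{−d−σ}, u satisfies ∂_t u = inf_{a∈A}(L_a u + f_a) pointwise in ℝ₀^{d+1}, and the seminorms [u]^t_{Λ¹} and [u]^*_σ over ℝ₀^{d+1} are finite. Then [u]^t_{Λ¹} + [u]^*_σ ≤ C·sup_{a∈A} ‖f_a‖_{L∞(ℝ₀^{d+1})}, where C depends only on d, λ, Λ, and σ. -/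

import Mathlib

open MeasureTheory Set Metric ENNReal
open scoped Classical
noncomputable section

namespace Nonlocal

variable {d : ℕ}

/-- `d`-dimensional Euclidean space. -/
abbrev E (d : ℕ) : Type := EuclideanSpace ℝ (Fin d)

/-- The parabolic cylinder `Q_r(t,x) = (t - r^σ, t) × B_r(x)`. -/
def Q (σ r t : ℝ) (x : E d) : Set (ℝ × E d) := Ioo (t - r ^ σ) t ×ˢ ball x r

/-- `Q_r = Q_r(0,0)`. -/
def Q0 (d : ℕ) (σ r : ℝ) : Set (ℝ × E d) := Q σ r 0 (0 : E d)

/-- The lower half space `ℝ₀^{d+1} = (-∞,0) × ℝ^d`. -/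
def lowerHalf (d : ℕ) : Set (ℝ × E d) := Iio (0 : ℝ) ×ˢ (univ : Set (E d))

/-- The spatial differential `Du`. -/
def Du (u : ℝ × E d → ℝ) (z : ℝ × E d) : E d →L[ℝ] ℝ :=
  fderiv ℝ (fun x => u (z.1, x)) z.2

/-- The time derivative `∂_t u`. -/
def ut (u : ℝ × E d → ℝ) (z : ℝ × E d) : ℝ :=
  deriv (fun s => u (s, z.2)) z.1

/-- The increment `δu(t,x,y)`, whose form depends on the order `σ`. -/
def deltaU (σ : ℝ) (u : ℝ × E d → ℝ) (t : ℝ) (x y : E d) : ℝ :=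
  u (t, x + y) - u (t, x) -
    (if 1 < σ then Du u (t, x) y
      else if σ = 1 then (if ‖y‖ < 1 then Du u (t, x) y else 0) else 0)

/-- Ellipticity bounds `λ(2-σ)|y|^{-d-σ} ≤ K(y) ≤ Λ(2-σ)|y|^{-d-σ}`. -/
def kernelBounds (σ lam Lam : ℝ) (K : E d → ℝ) : Prop :=
  ∀ y : E d, y ≠ 0 →
    lam * (2 - σ) * ‖y‖ ^ (-((d : ℝ) + σ)) ≤ K y ∧
      K y ≤ Lam * (2 - σ) * ‖y‖ ^ (-((d : ℝ) + σ))

/-- Cancellation condition `∫_{∂B_r} y K(y) dS(y) = 0` for all `r > 0`,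
formulated equivalently via vanishing of the integrals over all annuli. -/
def cancels (K : E d → ℝ) : Prop :=
  ∀ r₁ r₂ : ℝ, 0 < r₁ → r₁ < r₂ →
    (∫ y in {y : E d | r₁ ≤ ‖y‖ ∧ ‖y‖ ≤ r₂}, K y • y) = 0

/-- Membership in the class `L₀`. -/
def memL0 (σ lam Lam : ℝ) (K : E d → ℝ) : Prop :=
  kernelBounds σ lam Lam K ∧ (σ = 1 → cancels K)

/-- The nonlocal operator `L u(t,x) = ∫ δu(t,x,y) K(y) dy` (translation invariant kernel). -/
def Lop (σ : ℝ) (K : E d → ℝ) (u : ℝ × E d → ℝ) (z : ℝ × E d) : ℝ :=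
  ∫ y, deltaU σ u z.1 z.2 y * K y

/-- The nonlocal operator with `(t,x)`-dependent kernel. -/
def LopTX (σ : ℝ) (K : ℝ × E d → E d → ℝ) (u : ℝ × E d → ℝ) (z : ℝ × E d) : ℝ :=
  ∫ y, deltaU σ u z.1 z.2 y * K z y

/-- The maximal Pucci extremal operator `M⁺`. -/
def Mplus (σ lam Lam : ℝ) (u : ℝ × E d → ℝ) (z : ℝ × E d) : ℝ :=
  if σ = 1 then sSup {v | ∃ K : E d → ℝ, memL0 1 lam Lam K ∧ v = Lop 1 K u z}
  else ∫ y, (Lam * max (deltaU σ u z.1 z.2 y) 0 - lam * max (-deltaU σ u z.1 z.2 y) 0) *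
      ((2 - σ) * ‖y‖ ^ (-((d : ℝ) + σ)))

/-- The minimal Pucci extremal operator `M⁻`. -/
def Mminus (σ lam Lam : ℝ) (u : ℝ × E d → ℝ) (z : ℝ × E d) : ℝ :=
  if σ = 1 then sInf {v | ∃ K : E d → ℝ, memL0 1 lam Lam K ∧ v = Lop 1 K u z}
  else ∫ y, (lam * max (deltaU σ u z.1 z.2 y) 0 - Lam * max (-deltaU σ u z.1 z.2 y) 0) *
      ((2 - σ) * ‖y‖ ^ (-((d : ℝ) + σ)))

variable {F : Type*} [NormedAddCommGroup F]

/-- The parabolic Hölder seminorm `[f]_{β,α;Ω}` (exponent `β` in time and `α` in space). -/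
def holderE (β α : ℝ) (Ω : Set (ℝ × E d)) (f : ℝ × E d → F) : ℝ≥0∞ :=
  ⨆ (p : Ω) (q : Ω), ENNReal.ofReal
    (‖f p.1 - f q.1‖ / max (‖p.1.2 - q.1.2‖ ^ α) (|p.1.1 - q.1.1| ^ β))

/-- The sup norm `‖f‖_{L∞(Ω)}`. -/
def supENorm (Ω : Set (ℝ × E d)) (f : ℝ × E d → F) : ℝ≥0∞ :=
  ⨆ p : Ω, ENNReal.ofReal ‖f p.1‖

/-- The full Hölder norm `‖f‖_{β,α;Ω}`. -/
def pnormE (β α : ℝ) (Ω : Set (ℝ × E d)) (f : ℝ × E d → ℝ) : ℝ≥0∞ :=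
  supENorm Ω f + holderE β α Ω f

/-- The seminorm `[u]_{1+α/σ, σ+α; Ω} = [D^ν u]_{α/σ, σ+α-ν; Ω} + [∂_t u]_{α/σ, σ+α-ν; Ω}`
with `ν = ⌊σ+α⌋`. -/
def parab2Semi (σ α : ℝ) (Ω : Set (ℝ × E d)) (u : ℝ × E d → ℝ) : ℝ≥0∞ :=
  holderE (α / σ) (σ + α - (⌊σ + α⌋₊ : ℝ)) Ω
      (fun z => iteratedFDeriv ℝ ⌊σ + α⌋₊ (fun x => u (z.1, x)) z.2)
    + holderE (α / σ) (σ + α - (⌊σ + α⌋₊ : ℝ)) Ω (fun z => ut u z)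

/-- General parabolic seminorm `[u]_{β/σ, β; Ω}` of order `β ≥ 0` (sup norm for `β = 0`);
a time-derivative term appears when `β > σ`. -/
def pSemiGen (σ β : ℝ) (Ω : Set (ℝ × E d)) (u : ℝ × E d → ℝ) : ℝ≥0∞ :=
  if β = 0 then supENorm Ω u
  else
    holderE (if σ < β then (β - σ) / σ else β / σ) (β - ((⌈β⌉₊ : ℝ) - 1)) Ω
        (fun z => iteratedFDeriv ℝ (⌈β⌉₊ - 1) (fun x => u (z.1, x)) z.2)
      + (if σ < β then
          holderE ((β - σ) / σ) (β - ((⌈β⌉₊ : ℝ) - 1)) Ω (fun z => ut u z) else 0)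

/-- Hölder seminorm in `x` only: `[f]^*_{β;Ω}`. -/
def holderX (β : ℝ) (Ω : Set (ℝ × E d)) (f : ℝ × E d → F) : ℝ≥0∞ :=
  ⨆ (t : ℝ) (x : E d) (y : E d) (_ : (t, x) ∈ Ω) (_ : (t, y) ∈ Ω),
    ENNReal.ofReal (‖f (t, x) - f (t, y)‖ / ‖x - y‖ ^ β)

/-- Hölder seminorm in `t` only: `[f]^t_{β;Ω}`. -/
def holderT (β : ℝ) (Ω : Set (ℝ × E d)) (f : ℝ × E d → F) : ℝ≥0∞ :=
  ⨆ (t : ℝ) (s : ℝ) (x : E d) (_ : (t, x) ∈ Ω) (_ : (s, x) ∈ Ω),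
    ENNReal.ofReal (‖f (t, x) - f (s, x)‖ / |t - s| ^ β)

/-- Zygmund seminorm in `t` only: `[u]^t_{Λ¹(Ω)}`. -/
def zygT (Ω : Set (ℝ × E d)) (u : ℝ × E d → ℝ) : ℝ≥0∞ :=
  ⨆ (t : ℝ) (x : E d) (h : ℝ) (_ : 0 < h) (_ : (t, x) ∈ Ω) (_ : (t + h, x) ∈ Ω)
    (_ : (t - h, x) ∈ Ω),
    ENNReal.ofReal (|u (t + h, x) + u (t - h, x) - 2 * u (t, x)| / h)

/-- Zygmund seminorm in `(t,x)`: `[u]_{Λ¹(Ω)}`. -/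
def zygFull (Ω : Set (ℝ × E d)) (u : ℝ × E d → ℝ) : ℝ≥0∞ :=
  ⨆ (z : ℝ × E d) (h : ℝ × E d) (_ : h ≠ 0) (_ : z ∈ Ω) (_ : z + h ∈ Ω) (_ : z - h ∈ Ω),
    ENNReal.ofReal (|u (z + h) + u (z - h) - 2 * u z| / ‖h‖)

/-- The function `P(t,x)` of Lemma 3.3. -/
def Pfun (σ : ℝ) (u : ℝ × E d → ℝ) (z : ℝ × E d) : ℝ :=
  ∫ y, max (deltaU σ u z.1 z.2 y - deltaU σ u 0 (0 : E d) y) 0 *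
    ((2 - σ) * ‖y‖ ^ (-((d : ℝ) + σ)))

/-- The function `N(t,x)` of Lemma 3.3. -/
def Nfun (σ : ℝ) (u : ℝ × E d → ℝ) (z : ℝ × E d) : ℝ :=
  ∫ y, max (-(deltaU σ u z.1 z.2 y - deltaU σ u 0 (0 : E d) y)) 0 *
    ((2 - σ) * ‖y‖ ^ (-((d : ℝ) + σ)))

/-- Mollification of `u` in the time variable: `u^{(R)}`. -/
def tmoll (σ R : ℝ) (η : ℝ → ℝ) (u : ℝ × E d → ℝ) : ℝ × E d → ℝ :=
  fun z => ∫ s : ℝ, (2 * u (z.1 - R ^ σ * s, z.2) - u (z.1 - 2 * R ^ σ * s, z.2)) * η (s - 1)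

/-- First-order Taylor expansion of `u^{(R)}` at the origin. -/
def tmollTaylor (σ R : ℝ) (η : ℝ → ℝ) (u : ℝ × E d → ℝ) : ℝ × E d → ℝ :=
  fun z => tmoll σ R η u (0, 0)
    + z.1 * derivWithin (fun s => tmoll σ R η u (s, (0 : E d))) (Iio (0 : ℝ)) 0
    + fderiv ℝ (fun x => tmoll σ R η u ((0 : ℝ), x)) 0 z.2

/-- Mollification of `u` in space-time (case `σ = 1`). -/
def stmoll (R : ℝ) (η : ℝ → ℝ) (ζ : E d → ℝ) (u : ℝ × E d → ℝ) : ℝ × E d → ℝ :=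
  fun z => ∫ w : ℝ × E d,
    (2 * u (z.1 - R * w.1, z.2 - R • w.2) - u (z.1 - 2 * R * w.1, z.2 - R • w.2)) *
      (η (w.1 - 1) * ζ w.2)

/-- First-order Taylor expansion of the space-time mollification at the origin. -/
def stmollTaylor (R : ℝ) (η : ℝ → ℝ) (ζ : E d → ℝ) (u : ℝ × E d → ℝ) : ℝ × E d → ℝ :=
  fun z => stmoll R η ζ u (0, 0)
    + z.1 * derivWithin (fun s => stmoll R η ζ u (s, (0 : E d))) (Iio (0 : ℝ)) 0
    + fderiv ℝ (fun x => stmoll R η ζ u ((0 : ℝ), x)) 0 z.2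

end Nonlocal
open MeasureTheory Set Metric ENNReal Nonlocal

namespace Nonlocal

/-- The reference kernel `(2-σ)|y|^{-d-σ}`. -/
def refKernel (σ : ℝ) (y : E d) : ℝ := (2 - σ) * ‖y‖ ^ (-((d : ℝ) + σ))

/-- A gauge, linear near the origin and of order `σ/2` at infinity, at scale `r`. -/
def gauge (σ r : ℝ) (y : E d) : ℝ := min (‖y‖ / r) ((‖y‖ / r) ^ (σ / 2))

/-- The integral of the unit-scale gauge against the reference kernel. -/
def gaugeMass (d : ℕ) (σ : ℝ) : ℝ := ∫ y : E d, gauge σ 1 y * refKernel σ y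

lemma refKernel_nonneg {σ : ℝ} (hσ : σ ∈ Ioo (0 : ℝ) 1) (y : E d) : 0 ≤ refKernel σ y := by
  have := hσ.2
  exact mul_nonneg (by linarith) (Real.rpow_nonneg (norm_nonneg y) _)

lemma gauge_nonneg {σ r : ℝ} (hr : 0 < r) (y : E d) : 0 ≤ gauge σ r y :=
  le_min (by positivity) (by positivity)

lemma gauge_of_le {σ r : ℝ} (hσ : σ ∈ Ioo (0 : ℝ) 1) (hr : 0 < r) {y : E d} (hy : ‖y‖ ≤ r) :
    gauge σ r y = ‖y‖ / r := by
  refine min_eq_left ?_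
  have h0 : 0 ≤ ‖y‖ / r := by positivity
  have h1 : ‖y‖ / r ≤ 1 := (div_le_one hr).2 hy
  rcases h0.eq_or_lt with h | h
  · rw [← h, Real.zero_rpow (by linarith [hσ.1])]
  · simpa using Real.rpow_le_rpow_of_exponent_ge h h1 (show σ / 2 ≤ 1 by linarith [hσ.2])

lemma gauge_of_ge {σ r : ℝ} (hσ : σ ∈ Ioo (0 : ℝ) 1) (hr : 0 < r) {y : E d} (hy : r ≤ ‖y‖) :
    gauge σ r y = (‖y‖ / r) ^ (σ / 2) := by
  refine min_eq_right ?_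
  have h1 : 1 ≤ ‖y‖ / r := (one_le_div hr).2 hy
  simpa using Real.rpow_le_rpow_of_exponent_le h1 (show σ / 2 ≤ 1 by linarith [hσ.2])

lemma one_le_gauge {σ r : ℝ} (hσ : σ ∈ Ioo (0 : ℝ) 1) (hr : 0 < r) {y : E d} (hy : r ≤ ‖y‖) :
    1 ≤ gauge σ r y := by
  rw [gauge_of_ge hσ hr hy]
  exact Real.one_le_rpow ((one_le_div hr).2 hy) (by linarith [hσ.1])

lemma min_one_le_gauge {σ r : ℝ} (hσ : σ ∈ Ioo (0 : ℝ) 1) (hr : 0 < r) (y : E d) :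
    min 1 (‖y‖ / r) ≤ gauge σ r y := by
  rcases le_total ‖y‖ r with h | h
  · rw [gauge_of_le hσ hr h]; exact min_le_right _ _
  · exact (min_le_left _ _).trans (one_le_gauge hσ hr h)

lemma integrable_gauge_one (hd : 1 ≤ d) {σ : ℝ} (hσ : σ ∈ Ioo (0 : ℝ) 1) :
    Integrable (fun y : E d => gauge σ 1 y * refKernel σ y) := by
  have : Nonempty (Fin d) := ⟨⟨0, hd⟩⟩
  have hσ0 := hσ.1
  have hσ1 := hσ.2
  have key := integrable_fun_norm_addHaar (volume : Measure (E d))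
    (f := fun s : ℝ => min (s / 1) ((s / 1) ^ (σ / 2)) * ((2 - σ) * s ^ (-((d : ℝ) + σ))))
  refine key.2 ?_
  rw [finrank_euclideanSpace_fin, ← Ioc_union_Ioi_eq_Ioi (zero_le_one : (0 : ℝ) ≤ 1)]
  have hpow : ∀ s : ℝ, s ^ (d - 1) = s ^ ((d : ℝ) - 1) := fun s => by
    rw [← Real.rpow_natCast, Nat.cast_sub hd, Nat.cast_one]
  refine IntegrableOn.union ?_ ?_
  · have h := ((intervalIntegral.integrableOn_Ioo_rpow_iff (s := -σ) one_pos).2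
      (by linarith)).const_mul (2 - σ)
    rw [integrableOn_Ioc_iff_integrableOn_Ioo]
    refine (integrableOn_congr_fun ?_ measurableSet_Ioo).1 h
    intro s hs
    have hm : min (s / 1) ((s / 1) ^ (σ / 2)) = s := by
      rw [div_one]
      refine min_eq_left ?_
      simpa using Real.rpow_le_rpow_of_exponent_ge hs.1 hs.2.le (show σ / 2 ≤ 1 by linarith)
    simp only [smul_eq_mul, hm, hpow]
    rw [show s ^ ((d : ℝ) - 1) * (s * ((2 - σ) * s ^ (-((d : ℝ) + σ))))
      = (2 - σ) * (s ^ ((d : ℝ) - 1) * s ^ (1 : ℝ) * s ^ (-((d : ℝ) + σ))) by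
        rw [Real.rpow_one]; ring, ← Real.rpow_add hs.1, ← Real.rpow_add hs.1]
    congr 2; ring
  · have h := ((integrableOn_Ioi_rpow_iff (s := -1 - σ / 2) one_pos).2
      (by linarith)).const_mul (2 - σ)
    refine (integrableOn_congr_fun ?_ measurableSet_Ioi).1 h
    intro s hs
    have hs' : (1 : ℝ) < s := hs
    have hs0 : 0 < s := by linarith
    have hm : min (s / 1) ((s / 1) ^ (σ / 2)) = s ^ (σ / 2) := by
      rw [div_one]
      refine min_eq_right ?_
      simpa using Real.rpow_le_rpow_of_exponent_le hs'.le (show σ / 2 ≤ 1 by linarith)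
    simp only [smul_eq_mul, hm, hpow]
    rw [show s ^ ((d : ℝ) - 1) * (s ^ (σ / 2) * ((2 - σ) * s ^ (-((d : ℝ) + σ))))
      = (2 - σ) * (s ^ ((d : ℝ) - 1) * s ^ (σ / 2) * s ^ (-((d : ℝ) + σ))) by
        ring, ← Real.rpow_add hs0, ← Real.rpow_add hs0]
    congr 2; ring

lemma gauge_mul_refKernel_scale {σ r : ℝ} (hr : 0 < r) (y : E d) :
    gauge σ r y * refKernel σ y
      = r ^ (-((d : ℝ) + σ)) * (gauge σ 1 (r⁻¹ • y) * refKernel σ (r⁻¹ • y)) := by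
  have hn : ‖r⁻¹ • y‖ = ‖y‖ / r := by
    rw [norm_smul, norm_inv, Real.norm_of_nonneg hr.le]; ring
  have h2 : r ^ (-((d : ℝ) + σ)) * (‖y‖ / r) ^ (-((d : ℝ) + σ)) = ‖y‖ ^ (-((d : ℝ) + σ)) := by
    rw [← Real.mul_rpow hr.le (by positivity), mul_div_cancel₀ _ hr.ne']
  simp only [gauge, refKernel, hn, div_one]
  rw [← h2]; ring

lemma integrable_gauge (hd : 1 ≤ d) {σ r : ℝ} (hσ : σ ∈ Ioo (0 : ℝ) 1) (hr : 0 < r) :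
    Integrable (fun y : E d => gauge σ r y * refKernel σ y) := by
  simp only [gauge_mul_refKernel_scale hr]
  exact ((integrable_comp_smul_iff volume _ (inv_ne_zero hr.ne')).2
    (integrable_gauge_one hd hσ)).const_mul _

lemma integral_gauge {σ r : ℝ} (hr : 0 < r) :
    ∫ y : E d, gauge σ r y * refKernel σ y = gaugeMass d σ * r ^ (-σ) := by
  simp only [gauge_mul_refKernel_scale hr]
  rw [integral_const_mul,
    Measure.integral_comp_inv_smul_of_nonneg volume
      (fun y : E d => gauge σ 1 y * refKernel σ y) hr.le, finrank_euclideanSpace_fin, smul_eq_mul,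
    ← mul_assoc, ← Real.rpow_natCast, ← Real.rpow_add hr, mul_comm, gaugeMass]
  congr 2; ring

lemma gaugeMass_nonneg {σ : ℝ} (hσ : σ ∈ Ioo (0 : ℝ) 1) : 0 ≤ gaugeMass d σ :=
  integral_nonneg fun y => mul_nonneg (gauge_nonneg one_pos y) (refKernel_nonneg hσ y)

section Kernel

variable {σ lam Lam : ℝ} {K : E d → ℝ}

lemma ae_ne_zero (hd : 1 ≤ d) : ∀ᵐ y : E d, y ≠ 0 := by
  have : Nonempty (Fin d) := ⟨⟨0, hd⟩⟩
  rw [ae_iff]; simp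

lemma ae_kernel_bounds (hd : 1 ≤ d) (hK : kernelBounds σ lam Lam K) :
    ∀ᵐ y : E d, lam * refKernel σ y ≤ K y ∧ K y ≤ Lam * refKernel σ y := by
  filter_upwards [ae_ne_zero hd] with y hy
  simpa only [refKernel, mul_assoc] using hK y hy

lemma ae_kernel_nonneg (hd : 1 ≤ d) (hσ : σ ∈ Ioo (0 : ℝ) 1) (hlam : 0 < lam)
    (hK : kernelBounds σ lam Lam K) : ∀ᵐ y : E d, 0 ≤ K y := by
  filter_upwards [ae_kernel_bounds hd hK] with y hy
  exact (mul_nonneg hlam.le (refKernel_nonneg hσ y)).trans hy.1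

lemma measurable_refKernel : Measurable (refKernel (d := d) σ) := by
  unfold refKernel; fun_prop

/-- Integrability against the reference kernel gives integrability against any kernel of the
class. -/
lemma integrable_mul_kernel (hd : 1 ≤ d) (hσ : σ ∈ Ioo (0 : ℝ) 1) (hlam : 0 < lam)
    (hK : kernelBounds σ lam Lam K) (hKm : Measurable K) {g : E d → ℝ}
    (hg : Integrable (fun y => g y * refKernel σ y)) : Integrable (fun y => g y * K y) := by
  have hpos : ∀ᵐ y : E d, 0 < refKernel σ y := by
    filter_upwards [ae_ne_zero hd] with y hy
    exact mul_pos (by linarith [hσ.2]) (Real.rpow_pos_of_pos (norm_pos_iff.2 hy) _)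
  have hm : AEStronglyMeasurable (fun y => g y * K y) := by
    have h1 : AEStronglyMeasurable (fun y => (g y * refKernel σ y) * (K y / refKernel σ y)) :=
      hg.aestronglyMeasurable.mul (hKm.div measurable_refKernel).aestronglyMeasurable
    refine h1.congr ?_
    filter_upwards [hpos] with y hy
    field_simp
  refine (hg.const_mul Lam).mono hm ?_
  filter_upwards [ae_kernel_bounds hd hK, ae_kernel_nonneg hd hσ hlam hK, hpos] with y h1 h2 h3
  rw [norm_mul, norm_mul, norm_mul, Real.norm_of_nonneg h2, Real.norm_of_nonneg h3.le]
  have hL : refKernel σ y * Lam ≤ refKernel σ y * ‖Lam‖ :=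
    mul_le_mul_of_nonneg_left (Real.le_norm_self _) h3.le
  have := mul_le_mul_of_nonneg_left (h1.2.trans (by linarith :
    Lam * refKernel σ y ≤ refKernel σ y * ‖Lam‖)) (norm_nonneg (g y))
  linarith

lemma integral_mul_kernel_le (hd : 1 ≤ d) (hσ : σ ∈ Ioo (0 : ℝ) 1) (hlam : 0 < lam)
    (hK : kernelBounds σ lam Lam K) (hKm : Measurable K) {g : E d → ℝ}
    (hg0 : ∀ y, 0 ≤ g y) (hg : Integrable (fun y => g y * refKernel σ y)) :
    ∫ y, g y * K y ≤ Lam * ∫ y, g y * refKernel σ y := by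
  rw [← integral_const_mul]
  refine integral_mono_ae (integrable_mul_kernel hd hσ hlam hK hKm hg) (hg.const_mul _) ?_
  filter_upwards [ae_kernel_bounds hd hK] with y hy
  have := mul_le_mul_of_nonneg_left hy.2 (hg0 y)
  linarith

/-- The constant in the lower bound for the nonlocal jump contribution. -/
def jumpConst (d : ℕ) (σ lam : ℝ) : ℝ :=
  lam * (2 - σ) * 2 ^ (-((d : ℝ) + σ)) * volume.real (ball (0 : E d) 1)

lemma jumpConst_pos (hσ : σ ∈ Ioo (0 : ℝ) 1) (hlam : 0 < lam) : 0 < jumpConst d σ lam := by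
  have h1 : 0 < 2 - σ := by linarith [hσ.2]
  have h3 : 0 < volume.real (ball (0 : E d) 1) :=
    ENNReal.toReal_pos (measure_ball_pos _ _ one_pos).ne' measure_ball_lt_top.ne
  unfold jumpConst
  positivity

lemma refKernel_lower_bound (hσ : σ ∈ Ioo (0 : ℝ) 1) {r : ℝ} {y : E d} (hy0 : y ≠ 0)
    (hy : ‖y‖ ≤ 2 * r) : (2 - σ) * (2 * r) ^ (-((d : ℝ) + σ)) ≤ refKernel σ y := by
  have hp : 0 < (d : ℝ) + σ := by have := hσ.1; positivity
  exact mul_le_mul_of_nonneg_left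
    (Real.rpow_le_rpow_of_nonpos (norm_pos_iff.2 hy0) hy (by linarith)) (by linarith [hσ.2])

/-- Lower bound for the integral of a nonnegative jump function which is controlled from below
on pairs of points differing by `h`. -/
lemma jump_lower_bound (hd : 1 ≤ d) (hσ : σ ∈ Ioo (0 : ℝ) 1) (hlam : 0 < lam)
    (hK : kernelBounds σ lam Lam K) {D : E d → ℝ} (hD0 : ∀ y, 0 ≤ D y)
    (hDi : Integrable (fun y => D y * K y)) {h : E d} (hh : h ≠ 0)
    {B : ℝ} (hS : ∀ y, 2 * B ≤ D y + D (y + h)) :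
    B * (jumpConst d σ lam * ‖h‖ ^ (-σ)) ≤ ∫ y, D y * K y := by
  have hr : 0 < ‖h‖ := norm_pos_iff.2 hh
  set r := ‖h‖ with hr_def
  set κ := lam * ((2 - σ) * (2 * r) ^ (-((d : ℝ) + σ))) with hκ
  have hσ2 : 0 < 2 - σ := by linarith [hσ.2]
  have hκ0 : 0 ≤ κ := by positivity
  have htr : ∫ y, D (y + h) * K (y + h) = ∫ y, D y * K y :=
    integral_add_right_eq_self (fun y => D y * K y) h
  have hDi' : Integrable (fun y => D (y + h) * K (y + h)) := hDi.comp_add_right h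
  have hsum : 2 * ∫ y, D y * K y = ∫ y, (D y * K y + D (y + h) * K (y + h)) := by
    rw [integral_add hDi hDi', htr]; ring
  have hind : ∫ y, (ball (0 : E d) r).indicator (fun _ => κ * (2 * B)) y
      = volume.real (ball (0 : E d) 1) * r ^ (d : ℝ) * (κ * (2 * B)) := by
    rw [integral_indicator measurableSet_ball, setIntegral_const, smul_eq_mul, measureReal_def,
      Measure.addHaar_ball_of_pos _ _ hr, ENNReal.toReal_mul, finrank_euclideanSpace_fin,
      ENNReal.toReal_ofReal (by positivity), Real.rpow_natCast, measureReal_def]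
    ring
  have hle : ∫ y, (ball (0 : E d) r).indicator (fun _ => κ * (2 * B)) y
      ≤ ∫ y, (D y * K y + D (y + h) * K (y + h)) := by
    refine integral_mono_ae ?_ (hDi.add hDi') ?_
    · exact (integrable_indicator_iff measurableSet_ball).2
        (integrableOn_const measure_ball_lt_top.ne)
    · have hb := ae_kernel_bounds hd hK
      have hb' :=
        (measurePreserving_add_right (volume : Measure (E d)) h).quasiMeasurePreserving.ae hb
      have h0 := ae_ne_zero hd
      have h0' :=
        (measurePreserving_add_right (volume : Measure (E d)) h).quasiMeasurePreserving.ae h0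
      filter_upwards [hb, hb', h0, h0'] with y h1 h2 h3 h4
      have k1 : 0 ≤ K y := (mul_nonneg hlam.le (refKernel_nonneg hσ y)).trans h1.1
      have k2 : 0 ≤ K (y + h) := (mul_nonneg hlam.le (refKernel_nonneg hσ _)).trans h2.1
      by_cases hy : y ∈ ball (0 : E d) r
      · rw [indicator_of_mem hy]
        rw [mem_ball, dist_zero_right] at hy
        have n2 : ‖y + h‖ ≤ 2 * r := (norm_add_le _ _).trans (by linarith)
        have e1 : κ ≤ K y := le_trans (mul_le_mul_of_nonneg_left
          (refKernel_lower_bound hσ h3 (by linarith)) hlam.le) h1.1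
        have e2 : κ ≤ K (y + h) := le_trans (mul_le_mul_of_nonneg_left
          (refKernel_lower_bound hσ h4 n2) hlam.le) h2.1
        have a1 := mul_le_mul_of_nonneg_left e1 (hD0 y)
        have a2 := mul_le_mul_of_nonneg_left e2 (hD0 (y + h))
        have a3 := mul_le_mul_of_nonneg_left (hS y) hκ0
        linarith
      · rw [indicator_of_notMem hy]
        exact add_nonneg (mul_nonneg (hD0 _) k1) (mul_nonneg (hD0 _) k2)
  rw [hind, ← hsum] at hle
  have hfin : B * (jumpConst d σ lam * r ^ (-σ))
      = volume.real (ball (0 : E d) 1) * r ^ (d : ℝ) * (κ * B) := by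
    have : r ^ (-σ) = r ^ (d : ℝ) * r ^ (-((d : ℝ) + σ)) := by
      rw [← Real.rpow_add hr]; congr 1; ring
    rw [this, hκ, jumpConst, Real.mul_rpow zero_le_two hr.le]; ring
  linarith

end Kernel

/-- A function which is nonnegative initially and outside of a ball, and negative somewhere, has
a negative minimum, at which its time derivative is nonpositive. -/
lemma exists_negative_minimum {t₁ t₂ ρ : ℝ} {x₀ : E d} {φ : ℝ × E d → ℝ}
    (hφ : ContinuousOn φ (Icc t₁ t₂ ×ˢ univ)) (hinit : ∀ x, 0 ≤ φ (t₁, x))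
    (hout : ∀ t ∈ Icc t₁ t₂, ∀ x, ρ < ‖x - x₀‖ → 0 ≤ φ (t, x))
    (hneg : ∃ t ∈ Icc t₁ t₂, ∃ x, φ (t, x) < 0) :
    ∃ t ∈ Ioc t₁ t₂, ∃ x, φ (t, x) < 0 ∧ (∀ y, φ (t, x) ≤ φ (t, y)) ∧
      ∀ φ', HasDerivAt (fun s => φ (s, x)) φ' t → φ' ≤ 0 := by
  obtain ⟨s, hs, z, hz⟩ := hneg
  have hzρ : z ∈ closedBall x₀ ρ := by
    rw [mem_closedBall, dist_eq_norm]
    by_contra! h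
    exact absurd (hout s hs z h) (not_le.2 hz)
  have hcomp : IsCompact (Icc t₁ t₂ ×ˢ closedBall x₀ ρ) :=
    isCompact_Icc.prod (isCompact_closedBall _ _)
  obtain ⟨⟨t, x⟩, ⟨ht, hx⟩, hmin⟩ := hcomp.exists_isMinOn ⟨(s, z), hs, hzρ⟩
    (hφ.mono (prod_mono le_rfl (subset_univ _)))
  have hmin' : ∀ t' ∈ Icc t₁ t₂, ∀ y, φ (t, x) ≤ φ (t', y) := by
    intro t' ht' y
    by_cases hy : y ∈ closedBall x₀ ρ
    · exact hmin (show (t', y) ∈ _ from ⟨ht', hy⟩)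
    · have h1 : φ (t, x) ≤ φ (s, z) := hmin (show (s, z) ∈ _ from ⟨hs, hzρ⟩)
      rw [mem_closedBall, dist_eq_norm, not_le] at hy
      linarith [hout t' ht' y hy]
  have hlt : φ (t, x) < 0 := (hmin' s hs z).trans_lt hz
  simp only at ht
  have htne : t ≠ t₁ := by
    rintro rfl
    exact absurd (hinit x) (not_le.2 hlt)
  have ht1 : t₁ < t := lt_of_le_of_ne ht.1 htne.symm
  refine ⟨t, ⟨ht1, ht.2⟩, x, hlt, fun y => hmin' t ht y, fun φ' hφ' => ?_⟩
  have htend := hφ'.tendsto_slope.mono_left (nhdsWithin_mono t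
    (show Iio t ⊆ {t}ᶜ from fun a ha => ne_of_lt ha))
  refine le_of_tendsto htend ?_
  filter_upwards [Ioo_mem_nhdsLT ht1] with a ha
  rw [slope_def_field]
  exact div_nonpos_of_nonneg_of_nonpos
    (sub_nonneg.2 (hmin' a ⟨ha.1.le, ha.2.le.trans ht.2⟩ x)) (by linarith [ha.2])

lemma deltaU_of_lt_one {σ : ℝ} (hσ : σ < 1) (u : ℝ × E d → ℝ) (t : ℝ) (x y : E d) :
    deltaU σ u t x y = u (t, x + y) - u (t, x) := by
  simp [deltaU, hσ.not_gt, hσ.ne]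

lemma mem_lowerHalf {t : ℝ} {x : E d} : (t, x) ∈ lowerHalf d ↔ t < 0 := by
  simp [lowerHalf]

lemma isOpen_lowerHalf : IsOpen (lowerHalf d) := isOpen_Iio.prod isOpen_univ

/-- Time increments at step `τ` are controlled by averaged time increments at dyadic multiples. -/
lemma dyadic_time_increment {u : ℝ × E d → ℝ} {Z : ℝ}
    (hzyg : ∀ t x s, 0 < s → t + s < 0 → |u (t + s, x) + u (t - s, x) - 2 * u (t, x)| ≤ Z * s)
    {t τ : ℝ} (ht : t < 0) (hτ : 0 < τ) (x : E d) (k : ℕ) :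
    |(u (t, x) - u (t - τ, x)) - (u (t, x) - u (t - 2 ^ k * τ, x)) / 2 ^ k|
      ≤ k * (Z * τ / 2) := by
  induction k with
  | zero => simp
  | succ k ih =>
    have hp : (0 : ℝ) < 2 ^ k := by positivity
    have h := hzyg (t - 2 ^ k * τ) x (2 ^ k * τ) (by positivity) (by linarith)
    rw [sub_add_cancel, show t - 2 ^ k * τ - 2 ^ k * τ = t - 2 ^ (k + 1) * τ by ring] at h
    have e : (u (t, x) - u (t - τ, x)) - (u (t, x) - u (t - 2 ^ (k + 1) * τ, x)) / 2 ^ (k + 1)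
        = ((u (t, x) - u (t - τ, x)) - (u (t, x) - u (t - 2 ^ k * τ, x)) / 2 ^ k)
        + (u (t, x) + u (t - 2 ^ (k + 1) * τ, x) - 2 * u (t - 2 ^ k * τ, x)) / (2 * 2 ^ k) := by
      rw [pow_succ]; field_simp; ring
    have h2 : |(u (t, x) + u (t - 2 ^ (k + 1) * τ, x) - 2 * u (t - 2 ^ k * τ, x)) / (2 * 2 ^ k)|
        ≤ Z * τ / 2 := by
      rw [abs_div, abs_of_pos (by positivity : (0 : ℝ) < 2 * 2 ^ k), div_le_iff₀ (by positivity)]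
      linarith
    rw [e]
    refine (abs_add_le _ _).trans ?_
    push_cast
    linarith

/-- Interpolation between the spatial Hölder and the temporal Zygmund bounds for mixed
increments. -/
lemma mixed_increment_le {σ A Z r ε : ℝ} {u : ℝ × E d → ℝ} (hA : 0 ≤ A) (hZ : 0 ≤ Z)
    (hr : 0 < r) (hε : 0 < ε)
    (hold : ∀ t < 0, ∀ x y, |u (t, x) - u (t, y)| ≤ A * ‖x - y‖ ^ σ)
    (hzyg : ∀ t x s, 0 < s → t + s < 0 → |u (t + s, x) + u (t - s, x) - 2 * u (t, x)| ≤ Z * s)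
    {t b : ℝ} (ht : t < 0) (hbt : b < t) (htb : t - b ≤ r ^ σ) (x y : E d) :
    (u (t, x + y) - u (b, x + y)) - (u (t, x) - u (b, x))
      ≤ (2 / ε * A + ε * Z) * r ^ σ * (‖y‖ / r) ^ (σ / 2) := by
  set τ := t - b with hτ
  have hτ0 : 0 < τ := sub_pos.2 hbt
  set q := (‖y‖ / r) ^ (σ / 2) with hq
  have hq0 : 0 ≤ q := by positivity
  have hT : 0 < r ^ σ := Real.rpow_pos_of_pos hr σ
  have hyσ : ‖y‖ ^ σ = r ^ σ * (q * q) := by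
    have h : q * q = (‖y‖ / r) ^ σ := by
      rw [hq, ← pow_two, ← Real.rpow_natCast, ← Real.rpow_mul (by positivity)]
      congr 1
      push_cast
      ring
    rw [h, ← Real.mul_rpow hr.le (by positivity), mul_div_cancel₀ _ hr.ne']
  set k := ⌊ε * q⌋₊ with hk
  have hk1 : (k : ℝ) ≤ ε * q := Nat.floor_le (by positivity)
  have hk2 : ε * q ≤ 2 ^ k := by
    have h1 : ε * q < k + 1 := Nat.lt_floor_add_one _
    have h2 : k + 1 ≤ 2 ^ k := Nat.lt_two_pow_self
    have h3 : (k : ℝ) + 1 ≤ 2 ^ k := by exact_mod_cast h2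
    linarith
  have hp : (0 : ℝ) < 2 ^ k := by positivity
  have hb : t - τ = b := by rw [hτ]; ring
  have d1 := (abs_le.1 (dyadic_time_increment hzyg ht hτ0 (x + y) k)).2
  have d2 := (abs_le.1 (dyadic_time_increment hzyg ht hτ0 x k)).1
  rw [hb] at d1 d2
  have e1 := (abs_le.1 (hold t ht (x + y) x)).2
  have e2 := (abs_le.1 (hold (t - 2 ^ k * τ) (by nlinarith) (x + y) x)).1
  rw [add_sub_cancel_left] at e1 e2
  have e3 : (u (t, x + y) - u (t - 2 ^ k * τ, x + y)) / 2 ^ k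
      - (u (t, x) - u (t - 2 ^ k * τ, x)) / 2 ^ k ≤ 2 / ε * A * r ^ σ * q := by
    rw [← sub_div, div_le_iff₀ hp]
    have h1 : 2 * (A * ‖y‖ ^ σ) ≤ 2 / ε * A * r ^ σ * q * 2 ^ k := by
      rw [hyσ]
      calc 2 * (A * (r ^ σ * (q * q))) = 2 / ε * A * r ^ σ * q * (ε * q) := by field_simp
        _ ≤ _ := mul_le_mul_of_nonneg_left hk2 (by positivity)
    linarith
  have e4 : (k : ℝ) * (Z * τ) ≤ ε * q * (Z * r ^ σ) :=
    mul_le_mul hk1 (mul_le_mul_of_nonneg_left htb hZ) (by positivity) (by positivity)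
  linarith

lemma rpow_le_affine {σ r X : ℝ} (hσ : σ ∈ Ioo (0 : ℝ) 1) (hr : 0 < r) (hX : 0 ≤ X) :
    X ^ σ ≤ r ^ σ + r ^ σ / r * X := by
  have h : X ^ σ = r ^ σ * (X / r) ^ σ := by
    rw [← Real.mul_rpow hr.le (by positivity), mul_div_cancel₀ _ hr.ne']
  have hT : 0 < r ^ σ := Real.rpow_pos_of_pos hr σ
  have h2 : (X / r) ^ σ ≤ 1 + X / r := by
    rcases le_total (X / r) 1 with h1 | h1
    · have := Real.rpow_le_one (by positivity) h1 hσ.1.le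
      have h3 : 0 ≤ X / r := by positivity
      linarith
    · have := Real.rpow_le_rpow_of_exponent_le h1 hσ.2.le
      rw [Real.rpow_one] at this
      linarith
  calc X ^ σ = r ^ σ * (X / r) ^ σ := h
    _ ≤ r ^ σ * (1 + X / r) := mul_le_mul_of_nonneg_left h2 hT.le
    _ = _ := by ring

/-- If a function grows in time faster than with slope `c`, then it has a spatial cone-type contact
point at which its slope is at least `c` and its spatial increments are controlled by those at the
initial point. -/
lemma exists_contact_point {σ A Z r ε b t₀ c : ℝ} (hσ : σ ∈ Ioo (0 : ℝ) 1)
    {w : ℝ × E d → ℝ} (hA : 0 < A) (hZ : 0 ≤ Z) (hr : 0 < r) (hε : 0 < ε)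
    (hold : ∀ t < 0, ∀ x y, |w (t, x) - w (t, y)| ≤ A * ‖x - y‖ ^ σ)
    (hzyg : ∀ t x s, 0 < s → t + s < 0 → |w (t + s, x) + w (t - s, x) - 2 * w (t, x)| ≤ Z * s)
    (hw : ContinuousOn w (lowerHalf d)) (ht₀ : t₀ < 0) (hbt : b < t₀) (htb : t₀ - b ≤ r ^ σ)
    (x₀ : E d) (hgrow : w (b, x₀) + A * r ^ σ + c * (t₀ - b) < w (t₀, x₀)) :
    ∃ t < 0, ∃ x, (∀ y, w (t, x + y) - w (t, x) ≤
      (if r ≤ ‖y‖ then w (b, x₀ + y) - w (b, x₀) else 0)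
        + (2 * A + 2 / ε * A + ε * Z) * r ^ σ * gauge σ r y) ∧
      ∀ w', HasDerivAt (fun s => w (s, x)) w' t → c ≤ w' := by
  have hT : 0 < r ^ σ := Real.rpow_pos_of_pos hr σ
  set N := A * (r ^ σ / r) with hN
  have hN0 : 0 < N := by positivity
  have hneg : ∀ t ∈ Icc b t₀, t < 0 := fun t ht => ht.2.trans_lt ht₀
  have hspace : ∀ t ∈ Icc b t₀, ∀ x, w (t, x) ≤ w (t, x₀) + A * r ^ σ + N * ‖x - x₀‖ := by
    intro t ht x
    have h1 := (abs_le.1 (hold t (hneg t ht) x x₀)).2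
    have h2 := mul_le_mul_of_nonneg_left
      (rpow_le_affine hσ hr (norm_nonneg (x - x₀))) hA.le
    rw [hN]
    linarith
  have hslab : ContinuousOn w (Icc b t₀ ×ˢ univ) :=
    hw.mono fun z hz => mem_lowerHalf.2 (hneg _ hz.1)
  have hline : ContinuousOn (fun t => w (t, x₀) - c * (t - b)) (Icc b t₀) :=
    (hslab.comp (f := fun t : ℝ => (t, x₀)) (by fun_prop) fun t ht => ⟨ht, mem_univ _⟩).sub
      (by fun_prop)
  obtain ⟨W, hW⟩ := isCompact_Icc.bddAbove_image hline
  have hW' : ∀ t ∈ Icc b t₀, w (t, x₀) - c * (t - b) ≤ W := fun t ht => hW ⟨t, ht, rfl⟩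
  set φ : ℝ × E d → ℝ := fun z => w (b, x₀) + A * r ^ σ + c * (z.1 - b)
    + 2 * N * ‖z.2 - x₀‖ - w z with hφ
  obtain ⟨t, ht, x, hlt, hmin, hder⟩ := exists_negative_minimum (t₁ := b) (t₂ := t₀)
    (ρ := (W - w (b, x₀)) / N) (x₀ := x₀) (φ := φ)
    (ContinuousOn.sub (by fun_prop) hslab)
    (by
      intro x
      have h1 := hspace b ⟨le_rfl, hbt.le⟩ x
      have h2 : 0 ≤ N * ‖x - x₀‖ := by positivity
      simp only [hφ, sub_self, mul_zero]
      linarith)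
    (by
      intro t ht x hx
      rw [div_lt_iff₀ hN0] at hx
      have h1 := hspace t ht x
      have h2 := hW' t ht
      simp only [hφ]
      linarith)
    ⟨t₀, ⟨hbt.le, le_rfl⟩, x₀, by
      simp only [hφ, sub_self, norm_zero, mul_zero]
      linarith⟩
  have htn : t < 0 := ht.2.trans_lt ht₀
  refine ⟨t, htn, x, fun y => ?_, fun w' hw' => ?_⟩
  · have hcone : w (t, x + y) - w (t, x) ≤ 2 * N * ‖y‖ := by
      have h1 := hmin (x + y)
      have h2 : ‖x + y - x₀‖ ≤ ‖x - x₀‖ + ‖y‖ := by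
        rw [show x + y - x₀ = (x - x₀) + y by abel]; exact norm_add_le _ _
      have h3 := mul_le_mul_of_nonneg_left h2 (by positivity : 0 ≤ 2 * N)
      simp only [hφ] at h1
      linarith
    have hg := gauge_nonneg (σ := σ) hr y
    split_ifs with hy
    · have hloc : ‖x - x₀‖ ≤ r := by
        by_contra! hX
        have h1 := hmin x₀
        simp only [hφ, sub_self, norm_zero, mul_zero] at h1
        have h2 := (abs_le.1 (hold t htn x x₀)).2
        have h3 : ‖x - x₀‖ ^ σ ≤ r ^ σ / r * ‖x - x₀‖ := by
          have e : ‖x - x₀‖ ^ σ = r ^ σ * (‖x - x₀‖ / r) ^ σ := by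
            rw [← Real.mul_rpow hr.le (by positivity), mul_div_cancel₀ _ hr.ne']
          have := Real.rpow_le_rpow_of_exponent_le ((one_le_div hr).2 hX.le) hσ.2.le
          rw [Real.rpow_one] at this
          rw [e]
          calc _ ≤ r ^ σ * (‖x - x₀‖ / r) := mul_le_mul_of_nonneg_left this hT.le
            _ = _ := by ring
        have h4 := mul_le_mul_of_nonneg_left h3 hA.le
        have h5 : 0 < N * ‖x - x₀‖ := mul_pos hN0 (hr.trans hX)
        have h6 : N * ‖x - x₀‖ = A * (r ^ σ / r * ‖x - x₀‖) := by rw [hN]; ring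
        linarith
      have hXσ : A * ‖x - x₀‖ ^ σ ≤ A * r ^ σ :=
        mul_le_mul_of_nonneg_left (Real.rpow_le_rpow (norm_nonneg _) hloc hσ.1.le) hA.le
      have h1 := (abs_le.1 (hold t htn (x + y) (x₀ + y))).2
      have h2 := (abs_le.1 (hold t htn x x₀)).1
      rw [add_sub_add_right_eq_sub] at h1
      have h3 := mixed_increment_le hA.le hZ hr hε hold hzyg htn ht.1
        (by linarith [ht.2]) x₀ y
      rw [← gauge_of_ge hσ hr hy] at h3
      have h4 := mul_le_mul_of_nonneg_left (one_le_gauge hσ hr hy)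
        (by positivity : 0 ≤ 2 * A * r ^ σ)
      linarith
    · rw [not_le] at hy
      have h1 : 2 * N * ‖y‖ = 2 * A * r ^ σ * gauge σ r y := by
        rw [gauge_of_le hσ hr hy.le, hN]; ring
      have h2 : 0 ≤ (2 / ε * A + ε * Z) * r ^ σ * gauge σ r y := by positivity
      linarith
  · have d3 : HasDerivAt (fun s : ℝ => s - b) 1 t := (hasDerivAt_id t).sub_const b
    have := hder (c - w') ((((d3.const_mul c).const_add (w (b, x₀) + A * r ^ σ)).add_const
      (2 * N * ‖x - x₀‖)).sub hw' |>.congr_deriv (by ring))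
    linarith

/-- `u` is a smooth solution of the Bellman equation in the lower half space, with kernels of
order `σ` and data bounded by `F`. -/
structure IsBellmanSolution {ι : Type} (σ lam Lam F : ℝ) (K : ι → E d → ℝ) (f : ι → ℝ × E d → ℝ)
    (u : ℝ × E d → ℝ) : Prop where
  dim_pos : 1 ≤ d
  order : σ ∈ Ioo (0 : ℝ) 1
  lam_pos : 0 < lam
  kernel : ∀ a, kernelBounds σ lam Lam (K a)
  measurable : ∀ a, Measurable (K a)
  bound : ∀ a, ∀ z ∈ lowerHalf d, |f a z| ≤ F
  smooth : ContDiffOn ℝ (⊤ : ℕ∞) u (lowerHalf d)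
  integrable : ∀ z ∈ lowerHalf d,
    Integrable (fun y : E d => (u (z.1, z.2 + y) - u z) * refKernel σ y)
  eq : ∀ z ∈ lowerHalf d, ut u z = ⨅ a, (Lop σ (K a) u z + f a z)

namespace IsBellmanSolution

variable {ι : Type} {σ lam Lam F : ℝ} {K : ι → E d → ℝ} {f : ι → ℝ × E d → ℝ}
  {u : ℝ × E d → ℝ} (S : IsBellmanSolution σ lam Lam F K f u)

include S

lemma Lop_eq (a : ι) (t : ℝ) (x : E d) :
    Lop σ (K a) u (t, x) = ∫ y, (u (t, x + y) - u (t, x)) * K a y := by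
  simp only [Lop, deltaU_of_lt_one S.order.2]

lemma integrable_kernel (a : ι) {t : ℝ} (ht : t < 0) (x : E d) :
    Integrable (fun y => (u (t, x + y) - u (t, x)) * K a y) :=
  integrable_mul_kernel S.dim_pos S.order S.lam_pos (S.kernel a) (S.measurable a)
    (S.integrable (t, x) (mem_lowerHalf.2 ht))

lemma kernel_nonneg (a : ι) : ∀ᵐ y, 0 ≤ K a y :=
  ae_kernel_nonneg S.dim_pos S.order S.lam_pos (S.kernel a)

/-- Lower bound, uniform in the index, for integrals against the kernels. -/
lemma neg_le_integral {g : E d → ℝ} (hg : Integrable (fun y => g y * refKernel σ y)) (a : ι) :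
    -(Lam * ∫ y, |g y| * refKernel σ y) ≤ ∫ y, g y * K a y := by
  have hg' : Integrable (fun y => |g y| * refKernel σ y) := by
    refine hg.abs.congr (Filter.Eventually.of_forall fun y => ?_)
    simp only [abs_mul, abs_of_nonneg (refKernel_nonneg S.order y)]
  have h1 := integral_mul_kernel_le S.dim_pos S.order S.lam_pos (S.kernel a) (S.measurable a)
    (fun y => abs_nonneg (g y)) hg'
  have h2 : ∫ y, -(|g y| * K a y) ≤ ∫ y, g y * K a y := by
    refine integral_mono_ae (integrable_mul_kernel S.dim_pos S.order S.lam_pos (S.kernel a)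
      (S.measurable a) hg').neg (integrable_mul_kernel S.dim_pos S.order S.lam_pos (S.kernel a)
      (S.measurable a) hg) ?_
    filter_upwards [S.kernel_nonneg a] with y hy
    have := mul_le_mul_of_nonneg_right (neg_abs_le (g y)) hy
    linarith
  rw [integral_neg] at h2
  linarith

lemma ut_le (a : ι) {t : ℝ} (ht : t < 0) (x : E d) :
    ut u (t, x) ≤ Lop σ (K a) u (t, x) + f a (t, x) := by
  rw [S.eq _ (mem_lowerHalf.2 ht)]
  refine ciInf_le ⟨-(Lam * ∫ y, |u (t, x + y) - u (t, x)| * refKernel σ y) - F, ?_⟩ a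
  rintro _ ⟨b, rfl⟩
  have h1 := S.neg_le_integral (S.integrable (t, x) (mem_lowerHalf.2 ht)) b
  have h2 := (abs_le.1 (S.bound b (t, x) (mem_lowerHalf.2 ht))).1
  simp only [S.Lop_eq]
  linarith

lemma exists_lt_ut [Nonempty ι] {t : ℝ} (ht : t < 0) (x : E d) {η : ℝ} (hη : 0 < η) :
    ∃ a, Lop σ (K a) u (t, x) + f a (t, x) < ut u (t, x) + η := by
  refine exists_lt_of_ciInf_lt ?_
  rw [← S.eq _ (mem_lowerHalf.2 ht)]
  linarith

lemma hasDerivAt {t : ℝ} (ht : t < 0) (x : E d) :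
    HasDerivAt (fun s => u (s, x)) (ut u (t, x)) t := by
  have h1 : DifferentiableAt ℝ u (t, x) :=
    (S.smooth.contDiffAt (isOpen_lowerHalf.mem_nhds (mem_lowerHalf.2 ht))).differentiableAt
      (by simp)
  have h2 : DifferentiableAt ℝ (fun s : ℝ => u (s, x)) t :=
    h1.comp t (f := fun s : ℝ => (s, x)) (by fun_prop)
  exact h2.hasDerivAt

lemma continuousOn_shift (h : E d) {s : Set ℝ} (hs : ∀ t ∈ s, t < 0) :
    ContinuousOn (fun z : ℝ × E d => u (z.1, z.2 + h)) (s ×ˢ univ) :=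
  S.smooth.continuousOn.comp (by fun_prop) fun z hz => mem_lowerHalf.2 (hs _ hz.1)

lemma continuousOn_slab {s : Set ℝ} (hs : ∀ t ∈ s, t < 0) :
    ContinuousOn u (s ×ˢ univ) :=
  S.smooth.continuousOn.mono fun _ hz => mem_lowerHalf.2 (hs _ hz.1)

/-- A spatial increment of a solution cannot nearly saturate the Hölder seminorm, unless the data
are large. -/
lemma increment_le [Nonempty ι] {A κ : ℝ} (hA : 0 ≤ A) (hF : 0 < F)
    (hold : ∀ t < 0, ∀ x y, |u (t, x) - u (t, y)| ≤ A * ‖x - y‖ ^ σ) (hκ0 : 0 ≤ κ)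
    (hκ : κ * (1 + Lam * gaugeMass d σ + jumpConst d σ lam)
      ≤ jumpConst d σ lam * (1 - 2 ^ (σ - 1)))
    {t₀ : ℝ} (ht₀ : t₀ < 0) (x₀ : E d) {h : E d} (hh : h ≠ 0) :
    u (t₀, x₀ + h) - u (t₀, x₀) ≤ ((1 - κ) * A + 5 * F) * ‖h‖ ^ σ := by
  by_contra! hcon
  have hr : 0 < ‖h‖ := norm_pos_iff.2 hh
  set r := ‖h‖ with hr_def
  have hT : 0 < r ^ σ := Real.rpow_pos_of_pos hr σ
  set T := r ^ σ with hT_def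
  set t₁ := t₀ - T with ht₁
  set β : E d → ℝ := fun x => Real.exp (-(‖x - x₀‖ / r)) with hβ
  have hβ0 : ∀ x, 0 < β x := fun x => Real.exp_pos _
  have hβ1 : ∀ x, β x ≤ 1 := fun x => Real.exp_le_one_iff.2 (by
    have : 0 ≤ ‖x - x₀‖ / r := by positivity
    linarith)
  have hβy : ∀ x y, -(β x * gauge σ r y) ≤ β (x + y) - β x := by
    intro x y
    have h1 : β x * Real.exp (-(‖y‖ / r)) ≤ β (x + y) := by
      rw [hβ, ← Real.exp_add]
      refine Real.exp_le_exp.2 ?_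
      have : ‖x + y - x₀‖ ≤ ‖x - x₀‖ + ‖y‖ := by
        rw [show x + y - x₀ = (x - x₀) + y by abel]; exact norm_add_le _ _
      have := div_le_div_of_nonneg_right this hr.le
      rw [add_div] at this
      linarith
    have h2 : 1 - min 1 (‖y‖ / r) ≤ Real.exp (-(‖y‖ / r)) := by
      rcases le_total 1 (‖y‖ / r) with h | h
      · rw [min_eq_left h]; simpa using Real.exp_nonneg _
      · rw [min_eq_right h]; linarith [Real.add_one_le_exp (-(‖y‖ / r))]
    have h3 := mul_le_mul_of_nonneg_left
      (h2.trans' (sub_le_sub_left (min_one_le_gauge S.order hr y) 1)) (hβ0 x).le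
    linarith
  have hneg : ∀ t ∈ Icc t₁ t₀, t < 0 := fun t ht => ht.2.trans_lt ht₀
  have hw : ∀ t ∈ Icc t₁ t₀, ∀ x, u (t, x + h) - u (t, x) ≤ A * T := by
    intro t ht x
    have := hold t (hneg t ht) (x + h) x
    rw [add_sub_cancel_left] at this
    exact (le_abs_self _).trans this
  set φ : ℝ × E d → ℝ := fun z => A * T - (u (z.1, z.2 + h) - u z)
    - κ * A * (z.1 - t₁) * β z.2 + (F * T + 4 * F * (z.1 - t₁)) with hφ
  have hβc : Continuous β := by
    rw [hβ]; fun_prop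
  obtain ⟨t, ht, x, hlt, hmin, hder⟩ := exists_negative_minimum (t₁ := t₁) (t₂ := t₀)
    (ρ := r * (κ * A / F)) (x₀ := x₀) (φ := φ)
    (by
      have c1 := S.continuousOn_shift h hneg
      have c2 := S.continuousOn_slab hneg
      have c3 : ContinuousOn (fun z : ℝ × E d => κ * A * (z.1 - t₁) * β z.2)
        (Icc t₁ t₀ ×ˢ univ) := by fun_prop
      have c4 : ContinuousOn (fun z : ℝ × E d => F * T + 4 * F * (z.1 - t₁))
        (Icc t₁ t₀ ×ˢ univ) := by fun_prop
      exact ((continuousOn_const.sub (c1.sub c2)).sub c3).add c4)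
    (by
      intro x
      have := hw t₁ ⟨le_rfl, by linarith⟩ x
      have h2 : 0 < F * T := by positivity
      simp only [hφ, sub_self, mul_zero, zero_mul]
      linarith)
    (by
      intro t ht x hx
      have h1 := hw t ht x
      have h2 : κ * A * (t - t₁) * β x ≤ F * T := by
        have e1 : κ * A ≤ F * Real.exp (‖x - x₀‖ / r) := by
          have : κ * A / F ≤ ‖x - x₀‖ / r := by
            rw [le_div_iff₀ hr]; linarith
          have := this.trans ((le_add_of_nonneg_right zero_le_one).trans
            (Real.add_one_le_exp (‖x - x₀‖ / r)))
          rw [div_le_iff₀ hF] at this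
          linarith
        have e2 : κ * A * β x ≤ F := by
          have := mul_le_mul_of_nonneg_right e1 (hβ0 x).le
          rwa [mul_assoc F, hβ, ← Real.exp_add, add_neg_cancel, Real.exp_zero, mul_one] at this
        have e3 : t - t₁ ≤ T := by linarith [ht.2]
        have e4 : 0 ≤ t - t₁ := by linarith [ht.1]
        calc κ * A * (t - t₁) * β x = (κ * A * β x) * (t - t₁) := by ring
          _ ≤ F * T := mul_le_mul e2 e3 e4 hF.le
      have h3 : 0 ≤ 4 * F * (t - t₁) := mul_nonneg (by positivity) (by linarith [ht.1])
      simp only [hφ]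
      linarith)
    ⟨t₀, ⟨by linarith, le_rfl⟩, x₀, by
      have e : β x₀ = 1 := by simp [hβ]
      simp only [hφ, e, ht₁, _root_.sub_sub_cancel]
      linarith⟩
  have htn : t < 0 := ht.2.trans_lt ht₀
  set m := κ * A * (t - t₁) with hm
  have hm0 : 0 ≤ m := mul_nonneg (by positivity) (by linarith [ht.1])
  have hmT : m ≤ κ * A * T := mul_le_mul_of_nonneg_left (by linarith [ht.2]) (by positivity)
  have hde := hder (-(ut u (t, x + h) - ut u (t, x)) - κ * A * β x + 4 * F) (by
    have d1 := S.hasDerivAt htn (x + h)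
    have d2 := S.hasDerivAt htn x
    have d3 : HasDerivAt (fun s : ℝ => s - t₁) 1 t := (hasDerivAt_id t).sub_const t₁
    have := (((d1.sub d2).const_sub (A * T)).sub ((d3.const_mul (κ * A)).mul_const (β x))).add
      ((d3.const_mul (4 * F)).const_add (F * T))
    refine this.congr_deriv ?_
    ring)
  obtain ⟨a, ha⟩ := S.exists_lt_ut htn x hF
  have ha' := S.ut_le a htn (x + h)
  have f1 := (abs_le.1 (S.bound a (t, x) (mem_lowerHalf.2 htn))).1
  have f2 := (abs_le.1 (S.bound a (t, x + h) (mem_lowerHalf.2 htn))).2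
  rw [S.Lop_eq] at ha ha'
  have i1 := S.integrable_kernel a htn x
  have i2 := S.integrable_kernel a htn (x + h)
  have iG := integrable_mul_kernel S.dim_pos S.order S.lam_pos (S.kernel a) (S.measurable a)
    (integrable_gauge S.dim_pos S.order hr)
  have i12 : Integrable (fun y => (u (t, x + y) - u (t, x)) * K a y
      - (u (t, x + h + y) - u (t, x + h)) * K a y) := i1.sub i2
  set D : E d → ℝ := fun y => ((u (t, x + y) - u (t, x)) - (u (t, x + h + y) - u (t, x + h)))
    + m * β x * gauge σ r y with hD
  have hDeq : (fun y => D y * K a y) = fun y => ((u (t, x + y) - u (t, x)) * K a y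
      - (u (t, x + h + y) - u (t, x + h)) * K a y) + m * β x * (gauge σ r y * K a y) := by
    funext y; simp only [hD]; ring
  have hDi : Integrable (fun y => D y * K a y) := by
    rw [hDeq]; exact i12.add (iG.const_mul _)
  have hDint : ∫ y, D y * K a y = ((∫ y, (u (t, x + y) - u (t, x)) * K a y)
      - ∫ y, (u (t, x + h + y) - u (t, x + h)) * K a y)
      + m * β x * ∫ y, gauge σ r y * K a y := by
    rw [hDeq, integral_add i12 (iG.const_mul _), integral_sub i1 i2, integral_const_mul]
  have hD0 : ∀ y, 0 ≤ D y := by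
    intro y
    have h1 := hmin (x + y)
    simp only [hφ] at h1
    have h2 := mul_le_mul_of_nonneg_left (hβy x y) hm0
    simp only [hD]
    rw [add_right_comm x h y]
    linarith
  have hS : ∀ y, 2 * (A * T * (1 - 2 ^ (σ - 1)) - κ * A * T) ≤ D y + D (y + h) := by
    intro y
    simp only [hφ] at hlt
    have h1 : m * β x ≤ m := mul_le_of_le_one_right hm0 (hβ1 x)
    have h2 : 0 ≤ 4 * F * (t - t₁) := mul_nonneg (by positivity) (by linarith [ht.1])
    have h3 : 0 < F * T := by positivity
    have h4 := (le_abs_self _).trans (hold t htn (x + y + h + h) (x + y))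
    have h5 : ‖x + y + h + h - (x + y)‖ = 2 * r := by
      rw [show x + y + h + h - (x + y) = (2 : ℝ) • h by rw [two_smul]; abel, norm_smul]
      simp [hr_def]
    have h6 : (2 : ℝ) ^ σ = 2 * 2 ^ (σ - 1) := by
      rw [Real.rpow_sub_one two_ne_zero]; ring
    rw [h5, Real.mul_rpow zero_le_two hr.le, h6] at h4
    have h7 : 0 ≤ m * β x * gauge σ r y :=
      mul_nonneg (mul_nonneg hm0 (hβ0 x).le) (gauge_nonneg hr y)
    have h8 : 0 ≤ m * β x * gauge σ r (y + h) :=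
      mul_nonneg (mul_nonneg hm0 (hβ0 x).le) (gauge_nonneg hr _)
    simp only [hD]
    rw [show x + h + y = x + y + h by abel, show x + (y + h) = x + y + h by abel,
      show x + h + (y + h) = x + y + h + h by abel]
    linarith
  have hlow := jump_lower_bound S.dim_pos S.order S.lam_pos (S.kernel a) hD0 hDi hh hS
  have hTT : T * r ^ (-σ) = 1 := by
    rw [hT_def, ← Real.rpow_add hr, add_neg_cancel, Real.rpow_zero]
  have hlow' : A * jumpConst d σ lam * (1 - 2 ^ (σ - 1) - κ) ≤ ∫ y, D y * K a y := by
    refine le_trans (le_of_eq ?_) hlow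
    calc A * jumpConst d σ lam * (1 - 2 ^ (σ - 1) - κ)
        = A * jumpConst d σ lam * (1 - 2 ^ (σ - 1) - κ) * (T * r ^ (-σ)) := by rw [hTT, mul_one]
      _ = _ := by rw [← hr_def]; ring
  have hG : m * β x * ∫ y, gauge σ r y * K a y ≤ κ * A * (Lam * gaugeMass d σ) := by
    have g1 := integral_mul_kernel_le S.dim_pos S.order S.lam_pos (S.kernel a) (S.measurable a)
      (gauge_nonneg hr) (integrable_gauge S.dim_pos S.order hr)
    rw [integral_gauge hr] at g1
    have g0 : 0 ≤ ∫ y, gauge σ r y * K a y := by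
      refine integral_nonneg_of_ae ?_
      filter_upwards [S.kernel_nonneg a] with y hy
      exact mul_nonneg (gauge_nonneg hr y) hy
    calc m * β x * ∫ y, gauge σ r y * K a y
        ≤ (κ * A * T) * (Lam * (gaugeMass d σ * r ^ (-σ))) := by
          refine mul_le_mul ?_ g1 g0 (by positivity)
          exact (mul_le_of_le_one_right hm0 (hβ1 x)).trans hmT
      _ = κ * A * (Lam * gaugeMass d σ) * (T * r ^ (-σ)) := by ring
      _ = _ := by rw [hTT, mul_one]
  have hβA : κ * A * β x ≤ κ * A := mul_le_of_le_one_right (by positivity) (hβ1 x)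
  have hfin := mul_le_mul_of_nonneg_left hκ hA
  nlinarith

/-- Over a time step of length at most `r ^ σ` a solution evolves linearly in time, up to errors
that are small with respect to the temporal Zygmund bound. -/
lemma exists_slope [Nonempty ι] {A Z r ε b : ℝ} (hF : 0 < F) (hA : 0 < A)
    (hZ : 0 ≤ Z) (hr : 0 < r) (hε : 0 < ε)
    (hold : ∀ t < 0, ∀ x y, |u (t, x) - u (t, y)| ≤ A * ‖x - y‖ ^ σ)
    (hzyg : ∀ t x s, 0 < s → t + s < 0 → |u (t + s, x) + u (t - s, x) - 2 * u (t, x)| ≤ Z * s)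
    (hb : b < 0) (x₀ : E d) :
    ∃ c, ∀ t₀ < 0, b < t₀ → t₀ - b ≤ r ^ σ → |u (t₀, x₀) - u (b, x₀) - c * (t₀ - b)|
      ≤ A * r ^ σ + (Lam * gaugeMass d σ * (2 * A + 2 / ε * A + ε * Z) + 2 * F) * (t₀ - b) := by
  set H := 2 * A + 2 / ε * A + ε * Z with hH
  have hH0 : 0 ≤ H := by positivity
  set far : E d → ℝ := fun y => if r ≤ ‖y‖ then u (b, x₀ + y) - u (b, x₀) else 0 with hfar
  have hfi : Integrable (fun y => far y * refKernel σ y) := by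
    refine ((S.integrable (b, x₀) (mem_lowerHalf.2 hb)).indicator
      (measurableSet_le measurable_const measurable_norm : MeasurableSet {y : E d | r ≤ ‖y‖})).congr
      (Filter.Eventually.of_forall fun y => ?_)
    simp only [hfar, indicator_apply, mem_ofPred_eq, ite_mul, zero_mul]
  have hfa : ∀ a, Integrable (fun y => far y * K a y) := fun a =>
    integrable_mul_kernel S.dim_pos S.order S.lam_pos (S.kernel a) (S.measurable a) hfi
  have hga : ∀ a, Integrable (fun y => gauge σ r y * K a y) := fun a =>
    integrable_mul_kernel S.dim_pos S.order S.lam_pos (S.kernel a) (S.measurable a)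
      (integrable_gauge S.dim_pos S.order hr)
  have hgauge : ∀ a, H * r ^ σ * ∫ y, gauge σ r y * K a y ≤ Lam * gaugeMass d σ * H := by
    intro a
    have h1 := integral_mul_kernel_le S.dim_pos S.order S.lam_pos (S.kernel a) (S.measurable a)
      (gauge_nonneg hr) (integrable_gauge S.dim_pos S.order hr)
    rw [integral_gauge hr] at h1
    have hTT : r ^ σ * r ^ (-σ) = 1 := by
      rw [← Real.rpow_add hr, add_neg_cancel, Real.rpow_zero]
    have hT : 0 < r ^ σ := Real.rpow_pos_of_pos hr σ
    calc _ ≤ H * r ^ σ * (Lam * (gaugeMass d σ * r ^ (-σ))) :=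
          mul_le_mul_of_nonneg_left h1 (by positivity)
      _ = Lam * gaugeMass d σ * H * (r ^ σ * r ^ (-σ)) := by ring
      _ = _ := by rw [hTT, mul_one]
  have hint : ∀ a, ∫ y, (far y + H * r ^ σ * gauge σ r y) * K a y
      ≤ (∫ y, far y * K a y) + Lam * gaugeMass d σ * H := by
    intro a
    have e : (fun y => (far y + H * r ^ σ * gauge σ r y) * K a y)
        = fun y => far y * K a y + H * r ^ σ * (gauge σ r y * K a y) := by
      funext y; ring
    rw [e, integral_add (hfa a) ((hga a).const_mul _), integral_const_mul]
    linarith [hgauge a]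
  have hint_i : ∀ a, Integrable (fun y => (far y + H * r ^ σ * gauge σ r y) * K a y) := by
    intro a
    refine ((hfa a).add ((hga a).const_mul (H * r ^ σ))).congr
      (Filter.Eventually.of_forall fun y => ?_)
    simp only [Pi.add_apply]
    ring
  have hbdd : BddBelow (range fun a => ∫ y, far y * K a y) := by
    refine ⟨-(Lam * ∫ y, |far y| * refKernel σ y), ?_⟩
    rintro _ ⟨a, rfl⟩
    exact S.neg_le_integral hfi a
  set c₀ := ⨅ a, ∫ y, far y * K a y with hc₀
  set G := Lam * gaugeMass d σ * H with hG
  refine ⟨c₀, fun t₀ ht₀ hbt htb => abs_le.2 ⟨?_, ?_⟩⟩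
  · by_contra! hcon
    obtain ⟨t, ht, x, hinc, hslope⟩ := exists_contact_point (w := fun z => -u z)
      (c := -c₀ + (G + 2 * F)) S.order hA hZ hr hε
      (fun t ht x y => by
        rw [neg_sub_neg, abs_sub_comm]; exact hold t ht x y)
      (fun t x s hs hts => by
        rw [← abs_neg]
        refine (le_of_eq ?_).trans (hzyg t x s hs hts)
        congr 1; ring)
      S.smooth.continuousOn.neg ht₀ hbt htb x₀ (by linarith)
    have h1 := hslope _ (S.hasDerivAt ht x).neg
    obtain ⟨a, ha⟩ := S.exists_lt_ut ht x hF
    have f1 := (abs_le.1 (S.bound a (t, x) (mem_lowerHalf.2 ht))).1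
    rw [S.Lop_eq] at ha
    have h2 : ∫ y, -((u (t, x + y) - u (t, x)) * K a y)
        ≤ ∫ y, (-far y + H * r ^ σ * gauge σ r y) * K a y := by
      refine integral_mono_ae (S.integrable_kernel a ht x).neg ?_ ?_
      · refine ((hfa a).neg.add ((hga a).const_mul (H * r ^ σ))).congr
          (Filter.Eventually.of_forall fun y => ?_)
        simp only [Pi.add_apply, Pi.neg_apply]
        ring
      · filter_upwards [S.kernel_nonneg a] with y hy
        have h3 := hinc y
        have h4 : (if r ≤ ‖y‖ then -u (b, x₀ + y) - -u (b, x₀) else 0) = -far y := by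
          simp only [hfar]; split_ifs <;> ring
        rw [h4] at h3
        have h5 := mul_le_mul_of_nonneg_right h3 hy
        linarith
    have e : (fun y => (-far y + H * r ^ σ * gauge σ r y) * K a y)
        = fun y => H * r ^ σ * (gauge σ r y * K a y) - far y * K a y := by
      funext y; ring
    rw [integral_neg, e, integral_sub ((hga a).const_mul _) (hfa a), integral_const_mul] at h2
    have h3 := ciInf_le hbdd a
    have h4 := hgauge a
    linarith
  · by_contra! hcon
    obtain ⟨t, ht, x, hinc, hslope⟩ := exists_contact_point (c := c₀ + (G + 2 * F)) S.order hA hZ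
      hr hε hold hzyg S.smooth.continuousOn ht₀ hbt htb x₀ (by linarith)
    have h1 := hslope _ (S.hasDerivAt ht x)
    obtain ⟨a, ha⟩ := exists_lt_of_ciInf_lt (show c₀ < c₀ + F by linarith)
    have h2 := S.ut_le a ht x
    have f1 := (abs_le.1 (S.bound a (t, x) (mem_lowerHalf.2 ht))).2
    rw [S.Lop_eq] at h2
    have h3 : ∫ y, (u (t, x + y) - u (t, x)) * K a y
        ≤ ∫ y, (far y + H * r ^ σ * gauge σ r y) * K a y := by
      refine integral_mono_ae (S.integrable_kernel a ht x) (hint_i a) ?_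
      filter_upwards [S.kernel_nonneg a] with y hy
      exact mul_le_mul_of_nonneg_right (hinc y) hy
    have h4 := hint a
    linarith

/-- Self-improvement of the temporal Zygmund bound. -/
lemma second_difference_le [Nonempty ι] {A Z ε : ℝ} (hF : 0 < F) (hA : 0 < A)
    (hZ : 0 ≤ Z) (hε : 0 < ε)
    (hold : ∀ t < 0, ∀ x y, |u (t, x) - u (t, y)| ≤ A * ‖x - y‖ ^ σ)
    (hzyg : ∀ t x s, 0 < s → t + s < 0 → |u (t + s, x) + u (t - s, x) - 2 * u (t, x)| ≤ Z * s)
    {t s : ℝ} (hs : 0 < s) (hts : t + s < 0) (x : E d) :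
    |u (t + s, x) + u (t - s, x) - 2 * u (t, x)|
      ≤ (6 * A + 8 * F + 4 * (Lam * gaugeMass d σ * (2 * A + 2 / ε * A + ε * Z))) * s := by
  have hr : 0 < (2 * s) ^ (1 / σ) := Real.rpow_pos_of_pos (by linarith) _
  have hrσ : ((2 * s) ^ (1 / σ)) ^ σ = 2 * s := by
    rw [← Real.rpow_mul (by linarith), one_div, inv_mul_cancel₀ S.order.1.ne', Real.rpow_one]
  obtain ⟨c, hc⟩ := S.exists_slope hF hA hZ hr hε hold hzyg (b := t - s) (by linarith) x
  rw [hrσ] at hc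
  have h1 := abs_le.1 (hc (t + s) hts (by linarith) (by linarith))
  have h2 := abs_le.1 (hc t (by linarith) (by linarith) (by linarith))
  rw [show t + s - (t - s) = 2 * s by ring] at h1
  rw [_root_.sub_sub_cancel] at h2
  exact abs_le.2 ⟨by linarith, by linarith⟩

end IsBellmanSolution

lemma abs_sub_le_of_holderX {σ : ℝ} {u : ℝ × E d → ℝ} (hσ : 0 < σ)
    (h : holderX σ (lowerHalf d) u < ⊤) :
    ∀ t < 0, ∀ x y, |u (t, x) - u (t, y)| ≤ (holderX σ (lowerHalf d) u).toReal * ‖x - y‖ ^ σ := by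
  intro t ht x y
  rcases eq_or_ne x y with rfl | hxy
  · simp [Real.zero_rpow hσ.ne']
  · have hpos : 0 < ‖x - y‖ ^ σ := Real.rpow_pos_of_pos (norm_pos_iff.2 (sub_ne_zero.2 hxy)) σ
    rw [← div_le_iff₀ hpos, ← ENNReal.ofReal_le_iff_le_toReal h.ne]
    exact le_iSup₂_of_le t x <| le_iSup₂_of_le y (mem_lowerHalf.2 ht) <|
      le_iSup_of_le (mem_lowerHalf.2 ht) le_rfl

lemma holderX_le {σ B : ℝ} {u : ℝ × E d → ℝ} (hB : 0 ≤ B)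
    (h : ∀ t < 0, ∀ x y, x ≠ y → u (t, x) - u (t, y) ≤ B * ‖x - y‖ ^ σ) :
    holderX σ (lowerHalf d) u ≤ ENNReal.ofReal B := by
  refine iSup_le fun t => iSup_le fun x => iSup_le fun y => iSup_le fun ht => iSup_le fun _ =>
    ENNReal.ofReal_le_ofReal ?_
  rw [mem_lowerHalf] at ht
  rcases eq_or_ne x y with rfl | hxy
  · simpa using hB
  · rw [div_le_iff₀ (Real.rpow_pos_of_pos (norm_pos_iff.2 (sub_ne_zero.2 hxy)) σ), Real.norm_eq_abs,
      abs_le]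
    have h1 := h t ht y x hxy.symm
    rw [norm_sub_rev] at h1
    exact ⟨by linarith, h t ht x y hxy⟩

lemma second_difference_le_of_zygT {u : ℝ × E d → ℝ} (h : zygT (lowerHalf d) u < ⊤) :
    ∀ t x s, 0 < s → t + s < 0 →
      |u (t + s, x) + u (t - s, x) - 2 * u (t, x)| ≤ (zygT (lowerHalf d) u).toReal * s := by
  intro t x s hs hts
  rw [← div_le_iff₀ hs, ← ENNReal.ofReal_le_iff_le_toReal h.ne]
  exact le_iSup₂_of_le t x <| le_iSup₂_of_le s hs <|
    le_iSup₂_of_le (mem_lowerHalf.2 (by linarith)) (mem_lowerHalf.2 hts) <|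
      le_iSup_of_le (mem_lowerHalf.2 (by linarith)) le_rfl

lemma zygT_le {B : ℝ} {u : ℝ × E d → ℝ}
    (h : ∀ t x s, 0 < s → t + s < 0 →
      |u (t + s, x) + u (t - s, x) - 2 * u (t, x)| ≤ B * s) :
    zygT (lowerHalf d) u ≤ ENNReal.ofReal B := by
  refine iSup_le fun t => iSup_le fun x => iSup_le fun s => iSup_le fun hs => iSup_le fun _ =>
    iSup_le fun hts => iSup_le fun _ => ENNReal.ofReal_le_ofReal ?_
  rw [div_le_iff₀ hs]
  exact h t x s hs (mem_lowerHalf.1 hts)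

/-- The contraction rate of the spatial Hölder seminorm. -/
def contractionRate (d : ℕ) (σ lam Lam : ℝ) : ℝ :=
  jumpConst d σ lam * (1 - 2 ^ (σ - 1)) / (1 + Lam * gaugeMass d σ + jumpConst d σ lam)

lemma contractionRate_mem {σ lam Lam : ℝ} (hσ : σ ∈ Ioo (0 : ℝ) 1) (hlam : 0 < lam)
    (hLam : 0 ≤ Lam) : contractionRate d σ lam Lam ∈ Ioc 0 1 := by
  have hc : 0 < jumpConst d σ lam := jumpConst_pos hσ hlam
  have hG : 0 ≤ Lam * gaugeMass d σ := mul_nonneg hLam (gaugeMass_nonneg hσ)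
  have h2 : (2 : ℝ) ^ (σ - 1) < 1 :=
    Real.rpow_lt_one_of_one_lt_of_neg one_lt_two (by linarith [hσ.2])
  have h3 : (0 : ℝ) < 2 ^ (σ - 1) := Real.rpow_pos_of_pos two_pos _
  refine ⟨div_pos (mul_pos hc (by linarith)) (by linarith), ?_⟩
  rw [contractionRate, div_le_one (by linarith)]
  nlinarith

/-- The constant in the spatial Hölder estimate. -/
def holderConst (d : ℕ) (σ lam Lam : ℝ) : ℝ := 5 / contractionRate d σ lam Lam

lemma holderConst_pos {σ lam Lam : ℝ} (hσ : σ ∈ Ioo (0 : ℝ) 1) (hlam : 0 < lam)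
    (hLam : 0 ≤ Lam) : 0 < holderConst d σ lam Lam :=
  div_pos (by norm_num) (contractionRate_mem hσ hlam hLam).1

/-- The constant in the temporal Zygmund estimate. -/
def zygConst (d : ℕ) (σ lam Lam : ℝ) : ℝ :=
  12 * holderConst d σ lam Lam + 16 + 16 * (Lam * gaugeMass d σ) * holderConst d σ lam Lam
    * (1 + 8 * (Lam * gaugeMass d σ + 1))

lemma zygConst_pos {σ lam Lam : ℝ} (hσ : σ ∈ Ioo (0 : ℝ) 1) (hlam : 0 < lam)
    (hLam : 0 ≤ Lam) : 0 < zygConst d σ lam Lam := by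
  have hC : 0 < holderConst d σ lam Lam := holderConst_pos hσ hlam hLam
  have hG : 0 ≤ Lam * gaugeMass d σ := mul_nonneg hLam (gaugeMass_nonneg hσ)
  rw [zygConst]
  positivity

namespace IsBellmanSolution

variable {ι : Type} {σ lam Lam F : ℝ} {K : ι → E d → ℝ} {f : ι → ℝ × E d → ℝ}
  {u : ℝ × E d → ℝ} (S : IsBellmanSolution σ lam Lam F K f u)

include S

lemma holderX_toReal_le [Nonempty ι] (hLam : 0 ≤ Lam) (hF : 0 < F)
    (h : holderX σ (lowerHalf d) u < ⊤) :
    (holderX σ (lowerHalf d) u).toReal ≤ holderConst d σ lam Lam * F := by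
  set κ := contractionRate d σ lam Lam with hκ
  obtain ⟨hκ0, hκ1⟩ : κ ∈ Ioc 0 1 := contractionRate_mem S.order S.lam_pos hLam
  set A := (holderX σ (lowerHalf d) u).toReal with hA
  have hA0 : 0 ≤ A := ENNReal.toReal_nonneg
  have hc : 0 < jumpConst d σ lam := jumpConst_pos S.order S.lam_pos
  have hG : 0 ≤ Lam * gaugeMass d σ := mul_nonneg hLam (gaugeMass_nonneg S.order)
  have hB : 0 ≤ (1 - κ) * A + 5 * F :=
    add_nonneg (mul_nonneg (sub_nonneg.2 hκ1) hA0) (by positivity)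
  have h1 : A ≤ (1 - κ) * A + 5 * F := by
    refine ENNReal.toReal_le_of_le_ofReal hB (holderX_le hB fun t ht x y hxy => ?_)
    have := S.increment_le hA0 hF (abs_sub_le_of_holderX S.order.1 h) hκ0.le
      (by rw [hκ, contractionRate, div_mul_cancel₀ _ (by positivity)]) ht y (sub_ne_zero.2 hxy)
    rwa [add_sub_cancel] at this
  rw [holderConst, div_mul_eq_mul_div, le_div_iff₀ hκ0]
  linarith

lemma zygT_toReal_le [Nonempty ι] (hLam : 0 ≤ Lam) (hF : 0 < F)
    (h : holderX σ (lowerHalf d) u < ⊤) (hzyg : zygT (lowerHalf d) u < ⊤) :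
    (zygT (lowerHalf d) u).toReal ≤ zygConst d σ lam Lam * F := by
  have hG : 0 ≤ Lam * gaugeMass d σ := mul_nonneg hLam (gaugeMass_nonneg S.order)
  have hC : 0 < holderConst d σ lam Lam := holderConst_pos S.order S.lam_pos hLam
  set A := holderConst d σ lam Lam * F with hA
  have hA0 : 0 < A := mul_pos hC hF
  set G := Lam * gaugeMass d σ with hG_def
  set Z := (zygT (lowerHalf d) u).toReal with hZ
  have hZ0 : 0 ≤ Z := ENNReal.toReal_nonneg
  set ε := 1 / (8 * (G + 1)) with hε
  have hε0 : 0 < ε := by positivity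
  have hold : ∀ t < 0, ∀ x y, |u (t, x) - u (t, y)| ≤ A * ‖x - y‖ ^ σ := fun t ht x y =>
    (abs_sub_le_of_holderX S.order.1 h t ht x y).trans
      (mul_le_mul_of_nonneg_right (S.holderX_toReal_le hLam hF h) (by positivity))
  have h1 : Z ≤ 6 * A + 8 * F + 4 * (G * (2 * A + 2 / ε * A + ε * Z)) :=
    ENNReal.toReal_le_of_le_ofReal (by positivity) (zygT_le fun t x s hs hts =>
      S.second_difference_le hF hA0 hZ0 hε0 hold (second_difference_le_of_zygT hzyg) hs hts x)
  have h2 : 2 / ε = 16 * (G + 1) := by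
    rw [hε]; field_simp; norm_num
  have h3 : G * ε ≤ 1 / 8 := by
    rw [hε, mul_one_div, div_le_div_iff₀ (by positivity) (by norm_num)]
    linarith
  have h4 : G * (ε * Z) ≤ 1 / 8 * Z := by
    rw [← mul_assoc]; exact mul_le_mul_of_nonneg_right h3 hZ0
  rw [h2] at h1
  have h5 : zygConst d σ lam Lam * F
      = 12 * A + 16 * F + 16 * G * A * (1 + 8 * (G + 1)) := by
    rw [zygConst, hA]; ring
  rw [h5]
  linarith

end IsBellmanSolution

end Nonlocal

/-- Theorem 1.2 (i), case σ ∈ (0,1): global C^σ/Zygmund estimates for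
translation invariant equations with merely bounded data. -/
theorem statement2 (d : ℕ) (hd : 1 ≤ d) (σ lam Lam : ℝ)
    (hσ : σ ∈ Ioo (0 : ℝ) 1) (hlam : 0 < lam) (hlL : lam ≤ Lam) :
    ∃ C : ℝ, 0 < C ∧
      ∀ (ι : Type) (_ : Nonempty ι) (K : ι → E d → ℝ) (f : ι → ℝ × E d → ℝ)
        (u : ℝ × E d → ℝ),
        -- kernels in L₀, independent of (t,x)
        (∀ a, kernelBounds σ lam Lam (K a)) →
        (∀ a, Measurable (K a)) →
        -- sup_a ‖f_a‖_{L∞(ℝ₀^{d+1})} < ∞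
        (⨆ a, supENorm (lowerHalf d) (f a)) < ⊤ →
        -- u is smooth on ℝ₀^{d+1}
        ContDiffOn ℝ (⊤ : ℕ∞) u (lowerHalf d) →
        -- δu(t,x,·) is integrable against (2-σ)|y|^{-d-σ}
        (∀ z ∈ lowerHalf d,
          Integrable (fun y : E d =>
            deltaU σ u z.1 z.2 y * ((2 - σ) * ‖y‖ ^ (-((d : ℝ) + σ))))) →
        -- the equation u_t = inf_a (L_a u + f_a) in ℝ₀^{d+1}
        (∀ z ∈ lowerHalf d, ut u z = ⨅ a, (Lop σ (K a) u z + f a z)) →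
        -- finiteness of the seminorms [u]^t_{Λ¹} and [u]^*_σ
        zygT (lowerHalf d) u < ⊤ →
        holderX σ (lowerHalf d) u < ⊤ →
        zygT (lowerHalf d) u + holderX σ (lowerHalf d) u
          ≤ ENNReal.ofReal C * ⨆ a, supENorm (lowerHalf d) (f a) := by
  have hLam : 0 ≤ Lam := hlam.le.trans hlL
  have hH : 0 < holderConst d σ lam Lam := holderConst_pos hσ hlam hLam
  have hZ : 0 < zygConst d σ lam Lam := zygConst_pos hσ hlam hLam
  refine ⟨zygConst d σ lam Lam + holderConst d σ lam Lam, by positivity, ?_⟩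
  intro ι _ K f u hK hKm hf hu hint heq hzyg hhold
  set N := ⨆ a, supENorm (lowerHalf d) (f a) with hN
  have hbound : ∀ a, ∀ z ∈ lowerHalf d, |f a z| ≤ N.toReal := by
    intro a z hz
    rw [← ENNReal.ofReal_le_iff_le_toReal hf.ne]
    exact le_iSup_of_le a (le_iSup_of_le ⟨z, hz⟩ le_rfl)
  have key : ∀ η : ℝ, 0 < η → (zygT (lowerHalf d) u).toReal + (holderX σ (lowerHalf d) u).toReal
      ≤ (zygConst d σ lam Lam + holderConst d σ lam Lam) * (N.toReal + η) := by
    intro η hη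
    have S : IsBellmanSolution σ lam Lam (N.toReal + η) K f u :=
      { dim_pos := hd
        order := hσ
        lam_pos := hlam
        kernel := hK
        measurable := hKm
        bound := fun a z hz => (hbound a z hz).trans (by linarith)
        smooth := hu
        integrable := fun z hz => by
          simpa only [deltaU_of_lt_one hσ.2, refKernel] using hint z hz
        eq := heq }
    have hF : 0 < N.toReal + η := add_pos_of_nonneg_of_pos ENNReal.toReal_nonneg hη
    have h1 := S.holderX_toReal_le hLam hF hhold
    have h2 := S.zygT_toReal_le hLam hF hhold hzyg
    linarith
  have hfin : (zygT (lowerHalf d) u).toReal + (holderX σ (lowerHalf d) u).toReal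
      ≤ (zygConst d σ lam Lam + holderConst d σ lam Lam) * N.toReal := by
    refine le_of_forall_pos_le_add fun δ hδ => ?_
    have h := key (δ / (zygConst d σ lam Lam + holderConst d σ lam Lam)) (by positivity)
    rwa [mul_add, mul_div_cancel₀ _ (by positivity)] at h
  rw [← ENNReal.ofReal_toReal hf.ne, ← ENNReal.ofReal_mul (by positivity),
    ← ENNReal.ofReal_toReal hzyg.ne, ← ENNReal.ofReal_toReal hhold.ne,
    ← ENNReal.ofReal_add ENNReal.toReal_nonneg ENNReal.toReal_nonneg]
  exact ENNReal.ofReal_le_ofReal hfin
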